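/- Let f : ℝ → ℝ be differentiable with f(a) > 0 for all a, with f Lebesgue-integrable and f(a) → 0 as a → +∞ and as a → −∞, and write s(a) := f′(a)/f(a). Let μ, μ̂ : ℝ → ℝ be differentiable with μ, μ̂, μ′, μ̂′ bounded, let ŝ : ℝ → ℝ be bounded and measurable, and suppose μ′·f, μ̂′·f, μ·f′, μ̂·f′, and ŝ·(μ − μ̂)·f are Lebesgue-integrable. Then ∫ [μ̂′(a) − ŝ(a)·(μ(a) − μ̂(a)) − μ′(a)]·f(a) da = ∫ (s(a) − ŝ(a))·(μ(a) − μ̂(a))·f(a) da. -/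

import Mathlib

open MeasureTheory Filter

/-- second-order/doubly-robust bias identity, term T₁ in Theorem 1: for a
positive differentiable integrable density `f` vanishing at `±∞` with score `s = f'/f`,
true regression `μ` and estimated nuisances `μ̂`, `ŝ`, the bias of the
influence-function-based estimator is a product of the two nuisance errors:
`∫ (μ̂' - ŝ⬝(μ - μ̂) - μ')⬝f = ∫ (s - ŝ)⬝(μ - μ̂)⬝f`. -/
theorem doubly_robust_bias_identity
    (f : ℝ → ℝ) (hfd : Differentiable ℝ f) (hfpos : ∀ a, 0 < f a)
    (hfint : Integrable f)
    (htop : Tendsto f atTop (nhds 0)) (hbot : Tendsto f atBot (nhds 0))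
    (μ μhat : ℝ → ℝ) (hμd : Differentiable ℝ μ) (hμhatd : Differentiable ℝ μhat)
    (C₁ : ℝ) (hμb : ∀ a, |μ a| ≤ C₁)
    (C₂ : ℝ) (hμhatb : ∀ a, |μhat a| ≤ C₂)
    (C₃ : ℝ) (hμ'b : ∀ a, |deriv μ a| ≤ C₃)
    (C₄ : ℝ) (hμhat'b : ∀ a, |deriv μhat a| ≤ C₄)
    (shat : ℝ → ℝ) (hsm : Measurable shat)
    (C₅ : ℝ) (hsb : ∀ a, |shat a| ≤ C₅)
    (hint1 : Integrable (fun a => deriv μ a * f a))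
    (hint2 : Integrable (fun a => deriv μhat a * f a))
    (hint3 : Integrable (fun a => μ a * deriv f a))
    (hint4 : Integrable (fun a => μhat a * deriv f a))
    (hint5 : Integrable (fun a => shat a * (μ a - μhat a) * f a)) :
    ∫ a, (deriv μhat a - shat a * (μ a - μhat a) - deriv μ a) * f a =
      ∫ a, (deriv f a / f a - shat a) * (μ a - μhat a) * f a := by
  have hlim : ∀ l : Filter ℝ, Tendsto f l (nhds 0) →
      Tendsto (fun a => (μ a - μhat a) * f a) l (nhds 0) := by
    intro l hl
    have h2 : Tendsto (fun a => (C₁ + C₂) * |f a|) l (nhds 0) := by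
      simpa using hl.abs.const_mul (C₁ + C₂)
    refine squeeze_zero_norm (fun a => ?_) h2
    rw [Real.norm_eq_abs, abs_mul]
    have h3 : |μ a - μhat a| ≤ C₁ + C₂ :=
      (abs_sub _ _).trans (add_le_add (hμb a) (hμhatb a))
    exact mul_le_mul_of_nonneg_right h3 (abs_nonneg _)
  have hD : ∀ a, HasDerivAt (fun a => (μ a - μhat a) * f a)
      ((deriv μ a - deriv μhat a) * f a + (μ a - μhat a) * deriv f a) a := fun a =>
    ((hμd a).hasDerivAt.sub (hμhatd a).hasDerivAt).mul (hfd a).hasDerivAt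
  have hDint : Integrable (fun a =>
      (deriv μ a - deriv μhat a) * f a + (μ a - μhat a) * deriv f a) := by
    refine ((hint1.sub hint2).add (hint3.sub hint4)).congr (Eventually.of_forall fun a => ?_)
    simp only [Pi.add_apply, Pi.sub_apply]
    ring
  have hL : Integrable (fun a =>
      (deriv μhat a - shat a * (μ a - μhat a) - deriv μ a) * f a) := by
    refine ((hint2.sub hint5).sub hint1).congr (Eventually.of_forall fun a => ?_)
    simp only [Pi.sub_apply]
    ring
  have h0 := integral_of_hasDerivAt_of_tendsto hD hDint (hlim _ hbot) (hlim _ htop)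
  have hsum := integral_add hL hDint
  rw [h0, sub_zero, add_zero] at hsum
  rw [← hsum]
  refine integral_congr_ae (Eventually.of_forall fun a => ?_)
  have hne := (hfpos a).ne'
  simp only
  field_simp
  ring
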